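/- arXiv:1007.0297 — 2 statements merged into one kernel-verified Lean document; each statement's English description precedes it below -/
import Mathlib

section
/- One has ∫_{−∞}^{∞} log(1+t²)/(1+t²) dt = 2π log 2. -/
open MeasureTheory

theorem stmt_12 :
    (∫ t : ℝ, Real.log (1 + t ^ 2) / (1 + t ^ 2)) = 2 * Real.pi * Real.log 2 := by
  have himg : Real.arctan '' Set.univ = Set.Ioo (-(Real.pi / 2)) (Real.pi / 2) := by
    rw [Set.image_univ, Real.range_arctan]
  have h := integral_image_eq_integral_abs_deriv_smul (s := Set.univ) (f := Real.arctan)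
    (f' := fun t => 1 / (1 + t ^ 2)) MeasurableSet.univ
    (fun x _ => (Real.hasDerivAt_arctan x).hasDerivWithinAt)
    Real.arctan_injective.injOn (fun x => -2 * Real.log (Real.cos x))
  rw [himg, Measure.restrict_univ] at h
  have h2 : (∫ t : ℝ, Real.log (1 + t ^ 2) / (1 + t ^ 2)) =
      ∫ t : ℝ, |1 / (1 + t ^ 2)| • (-2 * Real.log (Real.cos (Real.arctan t))) := by
    congr 1
    funext t
    have hp : 0 < 1 + t ^ 2 := by positivity
    rw [abs_of_pos (by positivity), Real.cos_arctan, one_div (√_), Real.log_inv,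
      Real.log_sqrt hp.le, smul_eq_mul]
    field_simp
  rw [h2, ← h, ← integral_Ioc_eq_integral_Ioo,
    ← intervalIntegral.integral_of_le (by linarith [Real.pi_pos]),
    intervalIntegral.integral_const_mul]
  have h3 : ∫ x in (-(Real.pi / 2))..(Real.pi / 2), Real.log (Real.cos x) =
      ∫ x in (0 : ℝ)..Real.pi, Real.log (Real.sin x) := by
    have h4 := intervalIntegral.integral_comp_add_right (a := -(Real.pi / 2)) (b := Real.pi / 2)
      (fun x => Real.log (Real.sin x)) (Real.pi / 2)
    simp only [Real.sin_add_pi_div_two, neg_add_cancel, add_halves] at h4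
    exact h4
  rw [h3, integral_log_sin_zero_pi]
  ring
end

section
/- One has √3 · √π − 3 ∫_ℝ e^{-3y²} (2y³ − 3y)² dy = 2√π/(3√3); in particular this quantity is strictly positive. -/
open MeasureTheory

lemma aux_int (n : ℕ) : Integrable (fun x : ℝ => x ^ n * Real.exp (-3 * x ^ 2)) := by
  have h := integrable_rpow_mul_exp_neg_mul_sq (b := 3) (by norm_num) (s := (n : ℝ))
    (by have : (0 : ℝ) ≤ n := Nat.cast_nonneg n
        linarith)
  simpa using h

lemma aux_rec (n : ℕ) : ∫ x : ℝ, x ^ (n + 2) * Real.exp (-3 * x ^ 2)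
    = ((n : ℝ) + 1) / 6 * ∫ x : ℝ, x ^ n * Real.exp (-3 * x ^ 2) := by
  have hd : ∀ x : ℝ, HasDerivAt (fun x : ℝ => x ^ (n + 1) * Real.exp (-3 * x ^ 2))
      (((n : ℝ) + 1) * (x ^ n * Real.exp (-3 * x ^ 2))
        - 6 * (x ^ (n + 2) * Real.exp (-3 * x ^ 2))) x := by
    intro x
    have h1 := hasDerivAt_pow (n + 1) x
    have h2 := ((hasDerivAt_pow 2 x).const_mul (-3)).exp
    refine (h1.mul h2).congr_deriv ?_
    push_cast
    ring
  have h0 := integral_eq_zero_of_hasDerivAt_of_integrable hd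
    (((aux_int n).const_mul _).sub ((aux_int (n + 2)).const_mul _)) (aux_int (n + 1))
  rw [integral_sub ((aux_int n).const_mul _) ((aux_int (n + 2)).const_mul _),
    integral_const_mul, integral_const_mul] at h0
  linarith

lemma aux_val : ∫ y : ℝ, Real.exp (-3 * y ^ 2) * (2 * y ^ 3 - 3 * y) ^ 2
    = 7 / 9 * (Real.sqrt Real.pi / Real.sqrt 3) := by
  have e : (fun y : ℝ => Real.exp (-3 * y ^ 2) * (2 * y ^ 3 - 3 * y) ^ 2)
      = fun y : ℝ => 4 * (y ^ 6 * Real.exp (-3 * y ^ 2))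
        - 12 * (y ^ 4 * Real.exp (-3 * y ^ 2)) + 9 * (y ^ 2 * Real.exp (-3 * y ^ 2)) := by
    funext y
    ring
  have h0 : ∫ x : ℝ, x ^ 0 * Real.exp (-3 * x ^ 2) = Real.sqrt Real.pi / Real.sqrt 3 := by
    rw [← Real.sqrt_div Real.pi_pos.le, ← integral_gaussian]
    simp
  have h2 := aux_rec 0
  have h4 := aux_rec 2
  have h6 := aux_rec 4
  norm_num only [Nat.cast_ofNat, Nat.cast_zero] at h2 h4 h6
  have hs : Integrable (fun y : ℝ => 4 * (y ^ 6 * Real.exp (-3 * y ^ 2))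
        - 12 * (y ^ 4 * Real.exp (-3 * y ^ 2))) :=
    ((aux_int 6).const_mul _).sub ((aux_int 4).const_mul _)
  rw [e, integral_add hs ((aux_int 2).const_mul _),
    integral_sub ((aux_int 6).const_mul _) ((aux_int 4).const_mul _),
    integral_const_mul, integral_const_mul, integral_const_mul]
  linarith

theorem stmt_16 :
    (Real.sqrt 3 * Real.sqrt Real.pi -
        3 * (∫ y : ℝ, Real.exp (-3 * y ^ 2) * (2 * y ^ 3 - 3 * y) ^ 2)
      = 2 * Real.sqrt Real.pi / (3 * Real.sqrt 3)) ∧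
    (0 < Real.sqrt 3 * Real.sqrt Real.pi -
        3 * (∫ y : ℝ, Real.exp (-3 * y ^ 2) * (2 * y ^ 3 - 3 * y) ^ 2)) := by
  have key : Real.sqrt 3 * Real.sqrt Real.pi -
        3 * (∫ y : ℝ, Real.exp (-3 * y ^ 2) * (2 * y ^ 3 - 3 * y) ^ 2)
      = 2 * Real.sqrt Real.pi / (3 * Real.sqrt 3) := by
    rw [aux_val]
    have h3 : Real.sqrt 3 ^ 2 = 3 := Real.sq_sqrt (by norm_num)
    have hp : Real.sqrt 3 ≠ 0 := by positivity
    field_simp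
    rw [h3]
    ring
  refine ⟨key, ?_⟩
  rw [key]
  have := Real.pi_pos
  positivity
end
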